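/- Fix 0<α<1 and let γ:[0,∞)→(0,1) be twice continuously differentiable with γ' compactly supported in (0,1/2) and γ(r) = α for r ≥ 1/2. Set Γ(u) = (1/2){ log( γ(u)/(1−γ(u)) ) − log( α/(1−α) ) }, Γ_T(x) = Γ(σ_T(x)) for x ∈ ℤ²∖{0} and Γ_T(0) = Γ(0). Then there exists a function ε(T), depending only on γ and α, with ε(T) → 0 as T → ∞, such that for every configuration η ∈ {0,1}^{ℤ²}: | (log T / T) · ( −(T/2) Σ_{x ∈ ℤ²} Σ_{y : |y−x|=1} η(x)(1−η(y)) ( e^{Γ_T(y) − Γ_T(x)} − 1 ) ) + π ∫₀^∞ Γ''(r) μ^{1,T}(η)(dr) + W_γ(η) | ≤ ε(T), where W_γ(η) = (1/(4 log T)) Σ_{j=1,2} Σ_{x ∈ ℤ²∖{0}} Γ'(σ_T(x))² (x_j²/|x|⁴) [η(x+e_j) − η(x)]². -/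

import Mathlib

open MeasureTheory Set Filter
open scoped Classical
noncomputable section

/-- Square of the Euclidean norm of a point of `ℤ²`. -/
def nsq (x : ℤ × ℤ) : ℝ := ((x.1 : ℝ)) ^ 2 + ((x.2 : ℝ)) ^ 2

/-- Euclidean norm of a point of `ℤ²`. -/
def enorm2 (x : ℤ × ℤ) : ℝ := Real.sqrt (nsq x)

/-- `σ_T(x) = log |x| / log T`.  Note that `sig T 0 = 0`, so that
`Γ(sig T 0) = Γ(0)`. -/
def sig (T : ℝ) (x : ℤ × ℤ) : ℝ := Real.log (enorm2 x) / Real.log T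


def remR (d : ℝ) : ℝ := |Real.exp d - 1 - d - d^2/2| + |Real.exp (-d) - 1 + d - d^2/2|

lemma remR_zero : remR 0 = 0 := by simp [remR]

lemma remR_le (d : ℝ) (hd : |d| ≤ 1) : remR d ≤ 2 * |d|^3 := by
  have h1 := Real.exp_bound hd (n := 3) (by norm_num)
  have h2 := Real.exp_bound (x := -d) (by simpa using hd) (n := 3) (by norm_num)
  simp [Finset.sum_range_succ, Nat.factorial] at h1 h2
  have e1 : Real.exp d - (1 + d + d^2/2) = Real.exp d - 1 - d - d^2/2 := by ring
  have e2 : Real.exp (-d) - (1 + -d + d^2/2) = Real.exp (-d) - 1 + d - d^2/2 := by ring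
  rw [e1] at h1
  rw [e2] at h2
  unfold remR
  have : 0 ≤ |d|^3 := by positivity
  linarith

lemma bond (a b d : ℝ) (ha : a = 0 ∨ a = 1) (hb : b = 0 ∨ b = 1) :
    |a * (1 - b) * (Real.exp d - 1) + b * (1 - a) * (Real.exp (-d) - 1)
      - (a - b) * d - 1/2 * ((b - a)^2 * d^2)| ≤ remR d := by
  unfold remR
  have h1 := abs_nonneg (Real.exp d - 1 - d - d^2/2)
  have h2 := abs_nonneg (Real.exp (-d) - 1 + d - d^2/2)
  rcases ha with rfl | rfl <;> rcases hb with rfl | rfl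
  · simp; linarith
  · have : (0:ℝ) * (1 - 1) * (Real.exp d - 1) + 1 * (1 - 0) * (Real.exp (-d) - 1)
      - (0 - 1) * d - 1/2 * ((1 - 0)^2 * d^2) = Real.exp (-d) - 1 + d - d^2/2 := by ring
    rw [this]; linarith
  · have : (1:ℝ) * (1 - 0) * (Real.exp d - 1) + 0 * (1 - 1) * (Real.exp (-d) - 1)
      - (1 - 0) * d - 1/2 * ((0 - 1)^2 * d^2) = Real.exp (d) - 1 - d - d^2/2 := by ring
    rw [this]; linarith
  · simp; linarith

lemma dir_sum (S : Finset (ℤ × ℤ)) (G η : ℤ × ℤ → ℝ) (e : ℤ × ℤ)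
    (hη : ∀ x, η x = 0 ∨ η x = 1)
    (h1 : ∀ x ∉ S, G (x + e) = G x) (h2 : ∀ x ∉ S, G (x - e) = G x) :
    ∃ r : ℤ × ℤ → ℝ, (∀ x, |r x| ≤ remR (G (x + e) - G x)) ∧
      (∑' x, η x * (1 - η (x + e)) * (Real.exp (G (x + e) - G x) - 1))
      + (∑' x, η x * (1 - η (x - e)) * (Real.exp (G (x - e) - G x) - 1))
      = (∑' x, η x * (G (x + e) + G (x - e) - 2 * G x))
        + 1/2 * (∑' x, (η (x + e) - η x)^2 * (G (x + e) - G x)^2) + ∑' x, r x := by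
  have key : ∀ f : ℤ × ℤ → ℝ, (∀ x ∉ S, f x = 0) → Summable f := fun f hf =>
    summable_of_ne_finset_zero (s := S) hf
  set u : ℤ × ℤ → ℝ := fun x => η x * (1 - η (x + e)) * (Real.exp (G (x + e) - G x) - 1) with hu
  set v : ℤ × ℤ → ℝ := fun x => η x * (1 - η (x - e)) * (Real.exp (G (x - e) - G x) - 1) with hv
  have su : Summable u := key u (fun x hx => by simp [hu, h1 x hx])
  have sv : Summable v := key v (fun x hx => by simp [hv, h2 x hx])
  have sv' : Summable (fun x => v (x + e)) := (Equiv.addRight e).summable_iff.mpr sv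
  have tv : ∑' x, v (x + e) = ∑' x, v x := (Equiv.addRight e).tsum_eq v
  have sd1 : Summable (fun x => η x * (G (x + e) - G x)) :=
    key _ (fun x hx => by simp [h1 x hx])
  have sd2 : Summable (fun x => η x * (G x - G (x - e))) :=
    key _ (fun x hx => by simp [h2 x hx])
  have sd3 : Summable (fun x => η (x + e) * (G (x + e) - G x)) :=
    key _ (fun x hx => by simp [h1 x hx])
  have td : ∑' x, η (x + e) * (G (x + e) - G x) = ∑' x, η x * (G x - G (x - e)) := by
    have := (Equiv.addRight e).tsum_eq (fun x => η x * (G x - G (x - e)))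
    simpa using this
  have sq : Summable (fun x => (η (x + e) - η x)^2 * (G (x + e) - G x)^2) :=
    key _ (fun x hx => by simp [h1 x hx])
  refine ⟨fun x => u x + v (x + e) - (η x * (G (x + e) - G x) - η (x + e) * (G (x + e) - G x))
    - 1/2 * ((η (x + e) - η x)^2 * (G (x + e) - G x)^2), ?_, ?_⟩
  · intro x
    have := bond (η x) (η (x + e)) (G (x + e) - G x) (hη _) (hη _)
    convert this using 2
    simp only [hu, hv, add_sub_cancel_right, neg_sub]
    ring
  · rw [((su.add sv').sub (sd1.sub sd3)).tsum_sub (sq.mul_left _), (su.add sv').tsum_sub (sd1.sub sd3),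
      su.tsum_add sv', sd1.tsum_sub sd3, tv, td, tsum_mul_left]
    have : ∑' x, η x * (G (x + e) + G (x - e) - 2 * G x)
        = ∑' x, η x * (G (x + e) - G x) - ∑' x, η x * (G x - G (x - e)) := by
      rw [← sd1.tsum_sub sd2]
      exact tsum_congr fun x => by ring
    rw [this]
    ring

def errE (D : ℝ) (G L P1 P2 : ℤ × ℤ → ℝ) (x : ℤ × ℤ) : ℝ :=
  D / 2 * |(G (x + (1,0)) + G (x - (1,0)) - 2 * G x) + (G (x + (0,1)) + G (x - (0,1)) - 2 * G x)
      - L x / D^2|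
  + D / 4 * |(G (x + (1,0)) - G x)^2 - P1 x / D^2| + D / 4 * |(G (x + (0,1)) - G x)^2 - P2 x / D^2|
  + D / 2 * remR (G (x + (1,0)) - G x) + D / 2 * remR (G (x + (0,1)) - G x)

lemma main_ident (S : Finset (ℤ × ℤ)) (D T : ℝ) (hD : 0 < D) (hT : 0 < T) (G L P1 P2 η : ℤ × ℤ → ℝ)
    (hη : ∀ x, η x = 0 ∨ η x = 1)
    (h1 : ∀ x ∉ S, G (x + (1,0)) = G x) (h2 : ∀ x ∉ S, G (x - (1,0)) = G x)
    (h3 : ∀ x ∉ S, G (x + (0,1)) = G x) (h4 : ∀ x ∉ S, G (x - (0,1)) = G x)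
    (hL : ∀ x ∉ S, L x = 0) (hP1 : ∀ x ∉ S, P1 x = 0) (hP2 : ∀ x ∉ S, P2 x = 0) :
    |(D / T) * (-(T / 2) * ∑' x : ℤ × ℤ,
        (η x * (1 - η (x + (1, 0))) * (Real.exp (G (x + (1, 0)) - G x) - 1)
        + η x * (1 - η (x - (1, 0))) * (Real.exp (G (x - (1, 0)) - G x) - 1)
        + η x * (1 - η (x + (0, 1))) * (Real.exp (G (x + (0, 1)) - G x) - 1)
        + η x * (1 - η (x - (0, 1))) * (Real.exp (G (x - (0, 1)) - G x) - 1)))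
      + (1 / (2 * D)) * (∑' x, η x * L x)
      + (1 / (4 * D)) * ((∑' x, P1 x * (η (x + (1,0)) - η x)^2)
          + ∑' x, P2 x * (η (x + (0,1)) - η x)^2)|
    ≤ ∑' x, errE D G L P1 P2 x := by
  have key : ∀ f : ℤ × ℤ → ℝ, (∀ x ∉ S, f x = 0) → Summable f := fun f hf =>
    summable_of_ne_finset_zero (s := S) hf
  obtain ⟨r1, hr1, e1⟩ := dir_sum S G η (1,0) hη h1 h2
  obtain ⟨r2, hr2, e2⟩ := dir_sum S G η (0,1) hη h3 h4
  have sr1 : Summable r1 := key _ fun x hx => by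
    have := hr1 x
    rw [h1 x hx, sub_self, remR_zero] at this
    exact abs_nonpos_iff.mp this
  have sr2 : Summable r2 := key _ fun x hx => by
    have := hr2 x
    rw [h3 x hx, sub_self, remR_zero] at this
    exact abs_nonpos_iff.mp this
  have s1 : Summable (fun x => η x * (1 - η (x + (1, 0))) * (Real.exp (G (x + (1, 0)) - G x) - 1)) :=
    key _ fun x hx => by simp [h1 x hx]
  have s2 : Summable (fun x => η x * (1 - η (x - (1, 0))) * (Real.exp (G (x - (1, 0)) - G x) - 1)) :=
    key _ fun x hx => by simp [h2 x hx]
  have s3 : Summable (fun x => η x * (1 - η (x + (0, 1))) * (Real.exp (G (x + (0, 1)) - G x) - 1)) :=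
    key _ fun x hx => by simp [h3 x hx]
  have s4 : Summable (fun x => η x * (1 - η (x - (0, 1))) * (Real.exp (G (x - (0, 1)) - G x) - 1)) :=
    key _ fun x hx => by simp [h4 x hx]
  rw [((s1.add s2).add s3).tsum_add s4, (s1.add s2).tsum_add s3, s1.tsum_add s2, e1, eq_sub_of_add_eq e2]
  have a1 : Summable (fun x => η x * (G (x + (1,0)) + G (x - (1,0)) - 2 * G x)) :=
    key _ fun x hx => by simp only [h1 x hx, h2 x hx]; ring
  have a2 : Summable (fun x => η x * (G (x + (0,1)) + G (x - (0,1)) - 2 * G x)) :=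
    key _ fun x hx => by simp only [h3 x hx, h4 x hx]; ring
  have a3 : Summable (fun x => η x * L x) := key _ fun x hx => by simp [hL x hx]
  have b1 : Summable (fun x => (η (x + (1,0)) - η x)^2 * (G (x + (1,0)) - G x)^2) :=
    key _ fun x hx => by simp [h1 x hx]
  have b2 : Summable (fun x => (η (x + (0,1)) - η x)^2 * (G (x + (0,1)) - G x)^2) :=
    key _ fun x hx => by simp [h3 x hx]
  have b3 : Summable (fun x => P1 x * (η (x + (1,0)) - η x)^2) := key _ fun x hx => by simp [hP1 x hx]
  have b4 : Summable (fun x => P2 x * (η (x + (0,1)) - η x)^2) := key _ fun x hx => by simp [hP2 x hx]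
  have sE : Summable (errE D G L P1 P2) := key _ fun x hx => by
    simp only [errE, h1 x hx, h2 x hx, h3 x hx, h4 x hx, hL x hx, hP1 x hx, hP2 x hx, sub_self,
      remR_zero]
    ring_nf; simp
  set F : ℤ × ℤ → ℝ := fun x =>
    -(D/2) * (η x * (G (x + (1,0)) + G (x - (1,0)) - 2 * G x))
    + -(D/2) * (η x * (G (x + (0,1)) + G (x - (0,1)) - 2 * G x))
    + (1 / (2 * D)) * (η x * L x)
    + -(D/4) * ((η (x + (1,0)) - η x)^2 * (G (x + (1,0)) - G x)^2)
    + -(D/4) * ((η (x + (0,1)) - η x)^2 * (G (x + (0,1)) - G x)^2)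
    + (1 / (4 * D)) * (P1 x * (η (x + (1,0)) - η x)^2)
    + (1 / (4 * D)) * (P2 x * (η (x + (0,1)) - η x)^2)
    + -(D/2) * r1 x + -(D/2) * r2 x with hF
  have hs : HasSum F _ := ((((((((a1.hasSum.mul_left (-(D/2))).add (a2.hasSum.mul_left (-(D/2)))).add
    (a3.hasSum.mul_left (1 / (2 * D)))).add (b1.hasSum.mul_left (-(D/4)))).add
    (b2.hasSum.mul_left (-(D/4)))).add (b3.hasSum.mul_left (1/(4*D)))).add
    (b4.hasSum.mul_left (1/(4*D)))).add (sr1.hasSum.mul_left (-(D/2)))).add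
    (sr2.hasSum.mul_left (-(D/2)))
  have hbound : ∀ x, ‖F x‖ ≤ errE D G L P1 P2 x := by
    intro x
    have hF' : F x = -(D/2) * (η x * ((G (x + (1,0)) + G (x - (1,0)) - 2 * G x) +
        (G (x + (0,1)) + G (x - (0,1)) - 2 * G x) - L x / D^2))
      + -(D/4) * ((η (x + (1,0)) - η x)^2 * ((G (x + (1,0)) - G x)^2 - P1 x / D^2))
      + -(D/4) * ((η (x + (0,1)) - η x)^2 * ((G (x + (0,1)) - G x)^2 - P2 x / D^2))
      + -(D/2) * r1 x + -(D/2) * r2 x := by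
      simp only [hF]; field_simp; ring
    have hq : ∀ y z, |(η y - η z)^2| ≤ 1 := by
      intro y z
      rcases hη y with h | h <;> rcases hη z with h' | h' <;> rw [h, h'] <;> norm_num
    have hq1 : |η x| ≤ 1 := by rcases hη x with h | h <;> rw [h] <;> norm_num
    have m : ∀ a b : ℝ, |a| ≤ 1 → |a * b| ≤ |b| := fun a b h => by
      rw [abs_mul]; exact mul_le_of_le_one_left (abs_nonneg _) h
    have hc : ∀ c y z : ℝ, 0 < c → |y| ≤ z → |-c * y| ≤ c * z := fun c y z h h' => by
      rw [abs_mul, abs_neg, abs_of_pos h]; gcongr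
    rw [hF', Real.norm_eq_abs, errE]
    refine (abs_add_le _ _).trans (add_le_add ((abs_add_le _ _).trans (add_le_add
      ((abs_add_le _ _).trans (add_le_add ((abs_add_le _ _).trans (add_le_add ?_ ?_)) ?_)) ?_)) ?_)
    · exact hc _ _ _ (by positivity) (m _ _ hq1)
    · exact hc _ _ _ (by positivity) (m _ _ (hq _ _))
    · exact hc _ _ _ (by positivity) (m _ _ (hq _ _))
    · exact hc _ _ _ (by positivity) (hr1 x)
    · exact hc _ _ _ (by positivity) (hr2 x)
  have := tsum_of_norm_bounded sE.hasSum hbound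
  rw [hs.tsum_eq, Real.norm_eq_abs] at this
  convert this using 2
  field_simp
  ring

lemma sum_box (N : ℕ) :
    ∑ x ∈ Finset.Icc (-(N : ℤ × ℤ)) N, (if x ≠ 0 then 1 / (((x.1 : ℝ)) ^ 2 + ((x.2 : ℝ)) ^ 2) else 0)
      ≤ 8 * (harmonic N : ℝ) := by
  induction N with
  | zero => simp
  | succ n ih =>
    rw [← Finset.box_succ_disjUnion, Finset.sum_disjUnion, harmonic_succ]
    have : ∑ x ∈ Finset.box (n+1), (if x ≠ (0 : ℤ × ℤ) then 1 / (((x.1 : ℝ)) ^ 2 + ((x.2 : ℝ)) ^ 2) else 0)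
        ≤ ∑ x ∈ (Finset.box (n+1) : Finset (ℤ × ℤ)), 1 / ((n:ℝ)+1)^2 := by
      apply Finset.sum_le_sum
      intro x hx
      rw [Int.mem_box] at hx
      split_ifs
      · apply one_div_le_one_div_of_le (by positivity)
        have : (n:ℝ) + 1 = max |(x.1:ℝ)| |(x.2:ℝ)| := by
          have h : ((max x.1.natAbs x.2.natAbs : ℕ) : ℝ) = ((n + 1 : ℕ) : ℝ) := by rw [hx]
          push_cast [Nat.cast_natAbs] at h
          exact h.symm
        rw [this]
        rcases max_choice |(x.1:ℝ)| |(x.2:ℝ)| with h | h <;> rw [h, sq_abs] <;> nlinarith [sq_nonneg (x.1:ℝ), sq_nonneg (x.2:ℝ)]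
      · positivity
    rw [Finset.sum_const, Int.card_box (by simp)] at this
    have e : (8 * (n+1)) • (1 / ((n:ℝ)+1)^2) = 8 * ((n:ℝ)+1)⁻¹ := by
      rw [nsmul_eq_mul]; push_cast; field_simp
    rw [e] at this
    push_cast at *
    linarith

lemma mvt1 (f f' : ℝ → ℝ) (C : ℝ) (h : ∀ t ∈ Icc (-1:ℝ) 1, HasDerivAt f (f' t) t)
    (hb : ∀ t ∈ Icc (-1:ℝ) 1, |f' t| ≤ C) : ∀ t ∈ Icc (-1:ℝ) 1, |f t - f 0| ≤ C := by
  intro t ht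
  have hC : 0 ≤ C := (abs_nonneg _).trans (hb t ht)
  have := (convex_Icc (-1:ℝ) 1).norm_image_sub_le_of_norm_hasDerivWithin_le (f := f) (f' := f') (C := C)
    (fun x hx => (h x hx).hasDerivWithinAt) hb (x := 0) (y := t) (by norm_num) ht
  rw [Real.norm_eq_abs, Real.norm_eq_abs, sub_zero] at this
  have ht' : |t| ≤ 1 := abs_le.mpr ht
  nlinarith

lemma taylor1 (f f' f'' : ℝ → ℝ) (B K : ℝ)
    (h : ∀ t ∈ Icc (-1:ℝ) 1, HasDerivAt f (f' t) t)
    (h' : ∀ t ∈ Icc (-1:ℝ) 1, HasDerivAt f' (f'' t) t)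
    (hB : ∀ t ∈ Icc (-1:ℝ) 1, |f'' t| ≤ B)
    (hK : ∀ t ∈ Icc (-1:ℝ) 1, |f'' t - f'' 0| ≤ K) :
    |f 1 - f 0 - f' 0| ≤ B ∧ |f 1 + f (-1) - 2 * f 0 - f'' 0| ≤ 2 * K := by
  have m1 : (1:ℝ) ∈ Icc (-1:ℝ) 1 := by norm_num
  have m2 : (-1:ℝ) ∈ Icc (-1:ℝ) 1 := by norm_num
  constructor
  · have a := mvt1 f' f'' B h' hB
    have b := mvt1 (fun t => f t - f' 0 * t) (fun t => f' t - f' 0) B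
      (fun t ht => by
        have := (h t ht).sub ((hasDerivAt_id t).const_mul (f' 0))
        exact this.congr_deriv (by simp)) a 1 m1
    convert b using 2
    ring
  · have a := mvt1 (fun t => f' t - f'' 0 * t) (fun t => f'' t - f'' 0) K
      (fun t ht => by
        have := (h' t ht).sub ((hasDerivAt_id t).const_mul (f'' 0))
        exact this.congr_deriv (by simp)) hK
    have b := mvt1 (fun t => f t - f' 0 * t - f'' 0 * t^2 / 2)
      (fun t => (f' t - f'' 0 * t) - (f' 0 - f'' 0 * 0)) K
      (fun t ht => by
        have := ((h t ht).sub ((hasDerivAt_id t).const_mul (f' 0))).sub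
          ((((hasDerivAt_id t).pow 2).const_mul (f'' 0)).div_const 2)
        exact this.congr_deriv (by simp; ring)) a
    have b1 := abs_le.mp (b 1 m1)
    have b2 := abs_le.mp (b (-1) m2)
    rw [abs_le]
    constructor <;> nlinarith

lemma N_lower (u v ρ t : ℝ) (hρ : 2 ≤ ρ) (hN : u^2 + v^2 = ρ^2) (ht : t ∈ Icc (-1:ℝ) 1) :
    (ρ/2)^2 ≤ (u+t)^2 + v^2 := by
  have hu : |u| ≤ ρ := abs_le_of_sq_le_sq (by nlinarith [sq_nonneg v]) (by linarith)
  have ht' : |t| ≤ 1 := abs_le.mpr ht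
  have : |u * t| ≤ ρ * |t| := by rw [abs_mul]; gcongr
  have h2 := neg_abs_le (u * t)
  have h3 : t^2 = |t|^2 := (sq_abs t).symm
  nlinarith [abs_nonneg t]

lemma w_bounds (w v s : ℝ) (hs : 0 < s) (hN : s^2 ≤ w^2 + v^2) :
    |w / (w^2+v^2)| ≤ 1 / s ∧ |(v^2 - w^2) / (w^2+v^2)^2| ≤ 1 / s^2 ∧
    |(-6 * w) / (w^2+v^2)^2 + 8 * w^3 / (w^2+v^2)^3| ≤ 14 / s^3 := by
  set n := Real.sqrt (w^2+v^2) with hn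
  have hn2 : w^2 + v^2 = n^2 := (Real.sq_sqrt (by positivity)).symm
  have hsn : s ≤ n := Real.le_sqrt_of_sq_le hN
  have hn0 : 0 < n := by linarith
  have hw : |w| ≤ n := abs_le_of_sq_le_sq (by nlinarith [sq_nonneg v]) hn0.le
  rw [hn2]
  refine ⟨?_, ?_, ?_⟩
  · rw [abs_div, abs_of_pos (by positivity : 0 < n^2)]
    calc |w| / n^2 ≤ n / n^2 := by gcongr
      _ = 1 / n := by field_simp
      _ ≤ 1 / s := by gcongr
  · rw [abs_div, abs_of_pos (by positivity : 0 < (n^2)^2)]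
    have : |v^2 - w^2| ≤ n^2 := by
      rw [abs_le]; constructor <;> nlinarith [sq_nonneg v, sq_nonneg w]
    calc |v^2 - w^2| / (n^2)^2 ≤ n^2 / (n^2)^2 := by gcongr
      _ = 1 / n^2 := by field_simp
      _ ≤ 1 / s^2 := by gcongr
  · calc |(-6 * w) / (n^2)^2 + 8 * w^3 / (n^2)^3|
        ≤ |(-6 * w) / (n^2)^2| + |8 * w^3 / (n^2)^3| := abs_add_le _ _
      _ = 6 * |w| / (n^2)^2 + 8 * |w|^3 / (n^2)^3 := by
          rw [abs_div, abs_div, abs_mul, abs_mul, abs_pow w, abs_of_pos (by positivity : 0 < (n^2)^2),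
            abs_of_pos (by positivity : 0 < (n^2)^3)]
          norm_num
      _ ≤ 6 * n / (n^2)^2 + 8 * n^3 / (n^2)^3 := by gcongr
      _ = 14 / n^3 := by field_simp; norm_num
      _ ≤ 14 / s^3 := by gcongr

/-- one-dimensional estimates -/
lemma oneD (g g' g'' : ℝ → ℝ) (hg : ∀ r, HasDerivAt g (g' r) r) (hg' : ∀ r, HasDerivAt g' (g'' r) r)
    (M : ℝ) (hM1 : ∀ r, |g' r| ≤ M) (hM2 : ∀ r, |g'' r| ≤ M)
    (ε δ : ℝ) (hε : 0 < ε) (hδ : ∀ r s, |r - s| ≤ δ → |g'' r - g'' s| ≤ ε)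
    (u v ρ D : ℝ) (hD : 1 ≤ D) (hρ : 2 ≤ ρ) (hρδ : 2 ≤ ρ * δ) (hN : u^2 + v^2 = ρ^2)
    (f : ℝ → ℝ) (hf : f = fun t => g (Real.log ((u+t)^2+v^2) / (2*D))) :
    |f 1 - f 0| ≤ 2 * M / (D * ρ) ∧
    |(f 1 - f 0)^2 - (g' (Real.log (ρ^2) / (2*D)) * (u / ρ^2) / D)^2| ≤ 32 * M^2 / (D * ρ^3) ∧
    |f 1 + f (-1) - 2 * f 0 - (g'' (Real.log (ρ^2) / (2*D)) * (u/ρ^2)^2 / D^2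
      + g' (Real.log (ρ^2) / (2*D)) * ((v^2-u^2)/(ρ^2)^2) / D)|
      ≤ 2 * (4 * ε / (D^2 * ρ^2) + 136 * M / (D * ρ^3)) := by
  have hM : 0 ≤ M := (abs_nonneg _).trans (hM1 0)
  have hD0 : 0 < D := by linarith
  have hρ0 : 0 < ρ := by linarith
  set N : ℝ → ℝ := fun t => (u+t)^2+v^2 with hNdef
  have hNpos : ∀ t ∈ Icc (-1:ℝ) 1, 0 < N t := fun t ht =>
    lt_of_lt_of_le (by positivity) (N_lower u v ρ t hρ hN ht)
  set q : ℝ → ℝ := fun t => (u+t) / N t with hq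
  set q1 : ℝ → ℝ := fun t => (v^2 - (u+t)^2) / (N t)^2 with hq1
  set q2 : ℝ → ℝ := fun t => (-6 * (u+t)) / (N t)^2 + 8 * (u+t)^3 / (N t)^3 with hq2
  have bq : ∀ t ∈ Icc (-1:ℝ) 1, |q t| ≤ 2/ρ ∧ |q1 t| ≤ 4/ρ^2 ∧ |q2 t| ≤ 112/ρ^3 := fun t ht => by
    obtain ⟨a, b, c⟩ := w_bounds (u+t) v (ρ/2) (by positivity) (N_lower u v ρ t hρ hN ht)
    refine ⟨a.trans_eq ?_, b.trans_eq ?_, c.trans_eq ?_⟩ <;> field_simp <;> norm_num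
  have dN : ∀ t, HasDerivAt N (2*(u+t)) t := fun t => by
    have := (((hasDerivAt_id t).const_add u).pow 2).add_const (v^2)
    exact this.congr_deriv (by simp)
  have dw : ∀ t, HasDerivAt (fun t => u + t) 1 t := fun t => (hasDerivAt_id t).const_add u
  have dq : ∀ t ∈ Icc (-1:ℝ) 1, HasDerivAt q (q1 t) t := fun t ht => by
    have := (dw t).div (dN t) (hNpos t ht).ne'
    refine this.congr_deriv ?_
    simp only [hq1]; congr 1; simp only [hNdef]; ring
  have dq1 : ∀ t ∈ Icc (-1:ℝ) 1, HasDerivAt q1 (q2 t) t := fun t ht => by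
    have h0 := (hNpos t ht).ne'
    have := (((dw t).pow 2).const_sub (v^2)).div ((dN t).pow 2) (pow_ne_zero 2 h0)
    refine this.congr_deriv ?_
    simp only [hq2, Pi.pow_apply]
    have hv : v^2 = N t - (u+t)^2 := by simp only [hNdef]; ring
    rw [hv]
    field_simp
    push_cast
    ring
  set h : ℝ → ℝ := fun t => Real.log (N t) / (2*D) with hh
  have dh : ∀ t ∈ Icc (-1:ℝ) 1, HasDerivAt h (q t / D) t := fun t ht => by
    have := ((dN t).log (hNpos t ht).ne').div_const (2*D)
    refine this.congr_deriv ?_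
    simp only [hq]; have := (hNpos t ht).ne'; field_simp
  have hf' : f = fun t => g (h t) := hf
  have df : ∀ t ∈ Icc (-1:ℝ) 1, HasDerivAt f (g' (h t) * (q t / D)) t := fun t ht => by
    rw [hf']; exact (hg (h t)).comp t (dh t ht)
  have df' : ∀ t ∈ Icc (-1:ℝ) 1, HasDerivAt (fun t => g' (h t) * (q t / D))
      (g'' (h t) * (q t / D) * (q t / D) + g' (h t) * (q1 t / D)) t := fun t ht => by
    exact ((hg' (h t)).comp t (dh t ht)).mul ((dq t ht).div_const D)
  -- bounds
  have bqD : ∀ t ∈ Icc (-1:ℝ) 1, |q t / D| ≤ 2/(D*ρ) := fun t ht => by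
    rw [abs_div, abs_of_pos hD0]
    calc |q t| / D ≤ (2/ρ)/D := by gcongr; exact (bq t ht).1
      _ = _ := by field_simp
  have bq1D : ∀ t ∈ Icc (-1:ℝ) 1, |q1 t / D| ≤ 4/(D*ρ^2) := fun t ht => by
    rw [abs_div, abs_of_pos hD0]
    calc |q1 t| / D ≤ (4/ρ^2)/D := by gcongr; exact (bq t ht).2.1
      _ = _ := by field_simp
  have bh := mvt1 h _ _ dh bqD
  have bdq : ∀ t ∈ Icc (-1:ℝ) 1, |q t / D - q 0 / D| ≤ 4/(D*ρ^2) :=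
    mvt1 (fun t => q t / D) (fun t => q1 t / D) _ (fun t ht => (dq t ht).div_const D) bq1D
  have bdq1 : ∀ t ∈ Icc (-1:ℝ) 1, |q1 t / D - q1 0 / D| ≤ 112/(D*ρ^3) :=
    mvt1 (fun t => q1 t / D) (fun t => q2 t / D) _ (fun t ht => (dq1 t ht).div_const D)
      (fun t ht => by
        rw [abs_div, abs_of_pos hD0]
        calc |q2 t| / D ≤ (112/ρ^3)/D := by gcongr; exact (bq t ht).2.2
          _ = _ := by field_simp)
  have bg' : ∀ r s, |g' r - g' s| ≤ M * |r - s| := fun r s => by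
    have := (convex_univ (𝕜 := ℝ) (E := ℝ)).norm_image_sub_le_of_norm_hasDerivWithin_le (f := g') (f' := g'') (C := M)
      (fun x _ => (hg' x).hasDerivWithinAt) (fun x _ => hM2 x) (mem_univ s) (mem_univ r)
    simpa using this
  have m0 : (0:ℝ) ∈ Icc (-1:ℝ) 1 := by norm_num
  have m1 : (1:ℝ) ∈ Icc (-1:ℝ) 1 := by norm_num
  have bf' : ∀ t ∈ Icc (-1:ℝ) 1, |g' (h t) * (q t / D)| ≤ 2 * M / (D*ρ) := fun t ht => by
    rw [abs_mul]
    calc |g' (h t)| * |q t / D| ≤ M * (2/(D*ρ)) := by gcongr; exacts [hM1 _, bqD t ht]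
      _ = _ := by ring
  have bf'' : ∀ t ∈ Icc (-1:ℝ) 1,
      |g'' (h t) * (q t / D) * (q t / D) + g' (h t) * (q1 t / D)| ≤ 8 * M / (D*ρ^2) := fun t ht => by
    calc _ ≤ |g'' (h t) * (q t / D) * (q t / D)| + |g' (h t) * (q1 t / D)| := abs_add_le _ _
      _ = |g'' (h t)| * |q t / D| * |q t / D| + |g' (h t)| * |q1 t / D| := by simp only [abs_mul]
      _ ≤ M * (2/(D*ρ)) * (2/(D*ρ)) + M * (4/(D*ρ^2)) := by
          gcongr
          exacts [hM2 _, bqD t ht, bqD t ht, hM1 _, bq1D t ht]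
      _ = 4 * M / (D*ρ^2) * (1 / D) + 4 * M / (D * ρ^2) := by field_simp; ring
      _ ≤ 4 * M / (D*ρ^2) * 1 + 4 * M / (D * ρ^2) := by
          gcongr; rw [div_le_one hD0]; exact hD
      _ = _ := by ring
  have bK : ∀ t ∈ Icc (-1:ℝ) 1,
      |(g'' (h t) * (q t / D) * (q t / D) + g' (h t) * (q1 t / D))
        - (g'' (h 0) * (q 0 / D) * (q 0 / D) + g' (h 0) * (q1 0 / D))|
      ≤ 4 * ε / (D^2 * ρ^2) + 136 * M / (D * ρ^3) := fun t ht => by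
    have hδ' : |g'' (h t) - g'' (h 0)| ≤ ε := by
      apply hδ
      refine (bh t ht).trans ?_
      rw [div_le_iff₀ (by positivity)]
      have : 0 ≤ ρ * δ := by linarith
      nlinarith
    have hgl : |g' (h t) - g' (h 0)| ≤ M * (2/(D*ρ)) :=
      (bg' _ _).trans (by gcongr; exact bh t ht)
    have hsum : |q t / D + q 0 / D| ≤ 4/(D*ρ) := by
      refine (abs_add_le _ _).trans ?_
      have := bqD t ht; have := bqD 0 m0
      calc _ ≤ 2/(D*ρ) + 2/(D*ρ) := by gcongr
        _ = _ := by ring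
    have e : (g'' (h t) * (q t / D) * (q t / D) + g' (h t) * (q1 t / D))
        - (g'' (h 0) * (q 0 / D) * (q 0 / D) + g' (h 0) * (q1 0 / D))
        = (g'' (h t) - g'' (h 0)) * (q t / D) * (q t / D)
          + g'' (h 0) * (q t / D - q 0 / D) * (q t / D + q 0 / D)
          + (g' (h t) - g' (h 0)) * (q1 t / D) + g' (h 0) * (q1 t / D - q1 0 / D) := by ring
    rw [e]
    calc _ ≤ |(g'' (h t) - g'' (h 0)) * (q t / D) * (q t / D)|
          + |g'' (h 0) * (q t / D - q 0 / D) * (q t / D + q 0 / D)|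
          + |(g' (h t) - g' (h 0)) * (q1 t / D)| + |g' (h 0) * (q1 t / D - q1 0 / D)| := by
          refine (abs_add_le _ _).trans (add_le_add_left ((abs_add_le _ _).trans
            (add_le_add_left (abs_add_le _ _) _)) _)
      _ ≤ ε * (2/(D*ρ)) * (2/(D*ρ)) + M * (4/(D*ρ^2)) * (4/(D*ρ))
          + (M * (2/(D*ρ))) * (4/(D*ρ^2)) + M * (112/(D*ρ^3)) := by
          simp only [abs_mul]
          gcongr
          exacts [bqD t ht, bqD t ht, hM2 _, bdq t ht, bq1D t ht, hM1 _, bdq1 t ht]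
      _ = 4 * ε / (D^2 * ρ^2) + 24 * M / (D * ρ^3) * (1/D) + 112 * M / (D * ρ^3) := by
          field_simp; ring
      _ ≤ 4 * ε / (D^2 * ρ^2) + 24 * M / (D * ρ^3) * 1 + 112 * M / (D * ρ^3) := by
          gcongr; rw [div_le_one hD0]; exact hD
      _ = _ := by ring
  obtain ⟨t1, t2⟩ := taylor1 f _ _ _ _ df df' bf'' bK
  have hN0 : N 0 = ρ^2 := by simp [hNdef, hN]
  have hh0 : h 0 = Real.log (ρ^2) / (2*D) := by simp only [hh, hN0]
  have hq0 : q 0 = u / ρ^2 := by simp only [hq, hN0, add_zero]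
  have hq10 : q1 0 = (v^2-u^2)/(ρ^2)^2 := by simp only [hq1, hN0, add_zero]
  have bd := mvt1 f _ _ df bf' 1 m1
  refine ⟨bd, ?_, ?_⟩
  · have b0 := bf' 0 m0
    rw [hh0, hq0] at t1 b0
    set d := f 1 - f 0
    have e : g' (Real.log (ρ^2) / (2*D)) * (u / ρ^2) / D = g' (Real.log (ρ^2) / (2*D)) * (u / ρ^2 / D) := by ring
    rw [e]
    set p := g' (Real.log (ρ^2) / (2*D)) * (u / ρ^2 / D)
    have : d^2 - p^2 = (d - p) * (d + p) := by ring
    rw [this, abs_mul]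
    have hs : |d + p| ≤ 4 * M / (D*ρ) := by
      refine (abs_add_le _ _).trans ?_
      calc _ ≤ 2 * M / (D*ρ) + 2 * M / (D*ρ) := by gcongr
        _ = _ := by ring
    calc |d - p| * |d + p| ≤ (8 * M / (D*ρ^2)) * (4 * M / (D*ρ)) := by gcongr
      _ = 32 * M^2 / (D * ρ^3) * (1/D) := by field_simp; ring
      _ ≤ 32 * M^2 / (D * ρ^3) * 1 := by gcongr; rw [div_le_one hD0]; exact hD
      _ = _ := by ring
  · rw [hh0, hq0, hq10] at t2
    convert t2 using 3
    ring

lemma sig_eq (T : ℝ) (x : ℤ × ℤ) : sig T x = Real.log (nsq x) / (2 * Real.log T) := by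
  unfold sig enorm2
  rw [Real.log_sqrt (by unfold nsq; positivity)]
  ring

def LLf (g : ℝ → ℝ) (T : ℝ) (x : ℤ × ℤ) : ℝ := if x ≠ 0 then g (sig T x) / nsq x else 0
def PPa (g : ℝ → ℝ) (T : ℝ) (x : ℤ × ℤ) : ℝ :=
  if x ≠ 0 then (g (sig T x))^2 * (((x.1 : ℝ)) ^ 2 / (nsq x) ^ 2) else 0
def PPb (g : ℝ → ℝ) (T : ℝ) (x : ℤ × ℤ) : ℝ :=
  if x ≠ 0 then (g (sig T x))^2 * (((x.2 : ℝ)) ^ 2 / (nsq x) ^ 2) else 0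

lemma remR_bound (M D ρ d : ℝ) (hM : 0 ≤ M) (hD : 1 ≤ D) (hρ : 2 ≤ ρ) (hρM : 2 * M ≤ ρ)
    (hd : |d| ≤ 2 * M / (D * ρ)) : D / 2 * remR d ≤ 8 * M^3 / ρ^3 := by
  have hD0 : 0 < D := by linarith
  have hρ0 : 0 < ρ := by linarith
  have h1 : |d| ≤ 1 := hd.trans (by rw [div_le_one (by positivity)]; nlinarith)
  calc D / 2 * remR d ≤ D / 2 * (2 * |d|^3) := by gcongr; exact remR_le d h1
    _ ≤ D / 2 * (2 * (2 * M / (D * ρ))^3) := by gcongr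
    _ = 8 * M^3 / ρ^3 * (1 / D^2) := by field_simp; norm_num [mul_comm]
    _ ≤ 8 * M^3 / ρ^3 * 1 := by
        gcongr; rw [div_le_one (by positivity)]; nlinarith
    _ = _ := by ring

lemma errE_bound (g g' g'' : ℝ → ℝ) (hg : ∀ r, HasDerivAt g (g' r) r) (hg' : ∀ r, HasDerivAt g' (g'' r) r)
    (M : ℝ) (hM1 : ∀ r, |g' r| ≤ M) (hM2 : ∀ r, |g'' r| ≤ M)
    (ε δ : ℝ) (hε : 0 < ε) (hδ : ∀ r s, |r - s| ≤ δ → |g'' r - g'' s| ≤ ε)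
    (T : ℝ) (hD : 1 ≤ Real.log T) (x : ℤ × ℤ) (ρ : ℝ) (hρ : 2 ≤ ρ) (hρδ : 2 ≤ ρ * δ)
    (hρM : 2 * M ≤ ρ) (hN : nsq x = ρ^2) :
    errE (Real.log T) (fun x => g (sig T x)) (LLf g'' T) (PPa g' T) (PPb g' T) x
      ≤ 8 * ε / (Real.log T * ρ^2) + (272 * M + 16 * M^2 + 16 * M^3) / ρ^3 := by
  have hM : 0 ≤ M := (abs_nonneg _).trans (hM1 0)
  have hρ0 : 0 < ρ := by linarith
  have hx : x ≠ 0 := by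
    rintro rfl
    simp [nsq] at hN
    exact (pow_pos hρ0 2).ne hN
  set D := Real.log T with hDdef
  have hD0 : 0 < D := by linarith
  obtain ⟨a1, a2, a3⟩ := oneD g g' g'' hg hg' M hM1 hM2 ε δ hε hδ x.1 x.2 ρ D hD hρ hρδ hN _ rfl
  obtain ⟨b1, b2, b3⟩ := oneD g g' g'' hg hg' M hM1 hM2 ε δ hε hδ x.2 x.1 ρ D hD hρ hρδ
    (by rw [← hN, nsq]; ring) _ rfl
  have G0 : g (sig T x) = g (Real.log (((x.1:ℝ)+0)^2+(x.2:ℝ)^2) / (2*D)) := by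
    rw [sig_eq, nsq]; simp [hDdef]
  have G0' : g (sig T x) = g (Real.log (((x.2:ℝ)+0)^2+(x.1:ℝ)^2) / (2*D)) := by
    rw [sig_eq, nsq]; simp [hDdef, add_comm]
  have G1 : g (sig T (x + (1,0))) = g (Real.log (((x.1:ℝ)+1)^2+(x.2:ℝ)^2) / (2*D)) := by
    rw [sig_eq, nsq]; simp [hDdef]
  have G2 : g (sig T (x - (1,0))) = g (Real.log (((x.1:ℝ)+(-1))^2+(x.2:ℝ)^2) / (2*D)) := by
    rw [sig_eq, nsq]; simp [hDdef, sub_eq_add_neg]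
  have G3 : g (sig T (x + (0,1))) = g (Real.log (((x.2:ℝ)+1)^2+(x.1:ℝ)^2) / (2*D)) := by
    rw [sig_eq, nsq]; simp [hDdef, add_comm]
  have G4 : g (sig T (x - (0,1))) = g (Real.log (((x.2:ℝ)+(-1))^2+(x.1:ℝ)^2) / (2*D)) := by
    rw [sig_eq, nsq]; simp [hDdef, sub_eq_add_neg, add_comm]
  have hs : sig T x = Real.log (ρ^2) / (2*D) := by rw [sig_eq, hN]
  beta_reduce at a1 a2 a3 b1 b2 b3
  rw [← G0, ← G1] at a1 a2
  rw [← G0, ← G1, ← G2] at a3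
  rw [← G0', ← G3] at b1 b2
  rw [← G0', ← G3, ← G4] at b3
  rw [← hs] at a2 a3 b2 b3
  have hPa : PPa g' T x / D^2 = (g' (sig T x) * ((x.1:ℝ) / ρ^2) / D)^2 := by
    rw [PPa, if_pos hx, hN]; ring
  have hPb : PPb g' T x / D^2 = (g' (sig T x) * ((x.2:ℝ) / ρ^2) / D)^2 := by
    rw [PPb, if_pos hx, hN]; ring
  have hL : LLf g'' T x / D^2 =
      (g'' (sig T x) * ((x.1:ℝ)/ρ^2)^2 / D^2 + g' (sig T x) * (((x.2:ℝ)^2-(x.1:ℝ)^2)/(ρ^2)^2) / D)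
      + (g'' (sig T x) * ((x.2:ℝ)/ρ^2)^2 / D^2 + g' (sig T x) * (((x.1:ℝ)^2-(x.2:ℝ)^2)/(ρ^2)^2) / D) := by
    rw [LLf, if_pos hx, hN]
    have : (x.1:ℝ)^2 = ρ^2 - (x.2:ℝ)^2 := by rw [← hN, nsq]; ring
    simp only [div_pow]
    rw [this]
    field_simp
    ring
  unfold errE
  rw [hPa, hPb, hL]
  have r1 := remR_bound M D ρ _ hM hD hρ hρM a1
  have r2 := remR_bound M D ρ _ hM hD hρ hρM b1
  have k1 : D / 2 * |(g (sig T (x + (1,0))) + g (sig T (x - (1,0))) - 2 * g (sig T x))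
      + (g (sig T (x + (0,1))) + g (sig T (x - (0,1))) - 2 * g (sig T x))
      - ((g'' (sig T x) * ((x.1:ℝ)/ρ^2)^2 / D^2 + g' (sig T x) * (((x.2:ℝ)^2-(x.1:ℝ)^2)/(ρ^2)^2) / D)
      + (g'' (sig T x) * ((x.2:ℝ)/ρ^2)^2 / D^2 + g' (sig T x) * (((x.1:ℝ)^2-(x.2:ℝ)^2)/(ρ^2)^2) / D))|
      ≤ D / 2 * (2 * (4 * ε / (D^2 * ρ^2) + 136 * M / (D * ρ^3))
        + 2 * (4 * ε / (D^2 * ρ^2) + 136 * M / (D * ρ^3))) := by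
    rw [add_sub_add_comm]
    gcongr
    exact (abs_add_le _ _).trans (add_le_add a3 b3)
  have k2 := mul_le_mul_of_nonneg_left a2 (by positivity : 0 ≤ D / 4)
  have k3 := mul_le_mul_of_nonneg_left b2 (by positivity : 0 ≤ D / 4)
  refine (add_le_add (add_le_add (add_le_add (add_le_add k1 k2) k3) r1) r2).trans_eq ?_
  field_simp
  ring

lemma errE_nonneg (D : ℝ) (hD : 0 ≤ D) (G L P1 P2 : ℤ × ℤ → ℝ) (x : ℤ × ℤ) :
    0 ≤ errE D G L P1 P2 x := by
  unfold errE remR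
  positivity

lemma errE_zero (D c : ℝ) (G L P1 P2 : ℤ × ℤ → ℝ) (x : ℤ × ℤ) (h0 : G x = c)
    (h1 : G (x + (1,0)) = c) (h2 : G (x - (1,0)) = c) (h3 : G (x + (0,1)) = c) (h4 : G (x - (0,1)) = c)
    (hL : L x = 0) (hP1 : P1 x = 0) (hP2 : P2 x = 0) : errE D G L P1 P2 x = 0 := by
  unfold errE
  rw [h0, h1, h2, h3, h4, hL, hP1, hP2, sub_self, remR_zero]
  ring_nf; simp

lemma sig_ge (T : ℝ) (hT : 2 ≤ T) (y : ℤ × ℤ) (hy : T^2 ≤ nsq y) : 1/2 < sig T y := by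
  have hD : 0 < Real.log T := Real.log_pos (by linarith)
  have h : Real.log (T^2) ≤ Real.log (nsq y) := Real.log_le_log (by positivity) hy
  rw [Real.log_pow] at h
  push_cast at h
  rw [sig_eq, lt_div_iff₀ (by positivity)]
  linarith

lemma sig_low (T a : ℝ) (ha : 0 < a) (hT : 2 ≤ T) (y : ℤ × ℤ) (hy : nsq y < (T^a)^2) : sig T y < a := by
  have hT0 : 0 < T := by linarith
  have hD : 0 < Real.log T := Real.log_pos (by linarith)
  rw [sig_eq, div_lt_iff₀ (by positivity)]
  have hn : 0 ≤ nsq y := by unfold nsq; positivity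
  rcases hn.eq_or_lt with h | h
  · rw [← h, Real.log_zero]; positivity
  · have := Real.log_lt_log h hy
    rw [Real.log_pow, Real.log_rpow hT0] at this
    push_cast at this
    linarith

/-- neighbours stay inside the slightly larger disc -/
lemma nsq_nbr (x : ℤ × ℤ) (ρ : ℝ) (hρ : 0 ≤ ρ) (h : nsq x = ρ^2) :
    nsq (x + (1,0)) ≤ (ρ+1)^2 ∧ nsq (x - (1,0)) ≤ (ρ+1)^2 ∧
    nsq (x + (0,1)) ≤ (ρ+1)^2 ∧ nsq (x - (0,1)) ≤ (ρ+1)^2 := by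
  unfold nsq at *
  have h1 := abs_le.mp (abs_le_of_sq_le_sq (by nlinarith [sq_nonneg (x.2:ℝ)] : (x.1:ℝ)^2 ≤ ρ^2) hρ)
  have h2 := abs_le.mp (abs_le_of_sq_le_sq (by nlinarith [sq_nonneg (x.1:ℝ)] : (x.2:ℝ)^2 ≤ ρ^2) hρ)
  simp
  refine ⟨?_, ?_, ?_, ?_⟩ <;> nlinarith

lemma nsq_out (T : ℝ) (hT : 2 ≤ T) (N : ℕ) (hN : T + 2 ≤ N) (x : ℤ × ℤ)
    (hx : x ∉ Finset.Icc (-(N : ℤ × ℤ)) N) :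
    T^2 ≤ nsq x ∧ T^2 ≤ nsq (x + (1,0)) ∧ T^2 ≤ nsq (x - (1,0)) ∧
    T^2 ≤ nsq (x + (0,1)) ∧ T^2 ≤ nsq (x - (0,1)) := by
  have hc : (N:ℝ) ≤ |(x.1:ℝ)| ∨ (N:ℝ) ≤ |(x.2:ℝ)| := by
    by_contra! hcon
    apply hx
    obtain ⟨c1, c2⟩ := hcon
    have c1' : |x.1| < (N:ℤ) := by exact_mod_cast c1
    have c2' : |x.2| < (N:ℤ) := by exact_mod_cast c2
    rw [abs_lt] at c1' c2'
    rw [Finset.mem_Icc, Prod.le_def, Prod.le_def]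
    simp
    omega
  unfold nsq
  simp
  rcases hc with h | h <;> rw [le_abs] at h <;> rcases h with h | h <;>
    refine ⟨?_, ?_, ?_, ?_, ?_⟩ <;>
    nlinarith [sq_nonneg (x.1:ℝ), sq_nonneg (x.2:ℝ), sq_nonneg ((x.1:ℝ)+1), sq_nonneg ((x.1:ℝ)-1),
      sq_nonneg ((x.2:ℝ)+1), sq_nonneg ((x.2:ℝ)-1)]

lemma log_ceil (T : ℝ) (hT : 3 ≤ T) : Real.log ((⌈T⌉₊ + 2 : ℕ) : ℝ) ≤ 2 * Real.log T := by
  have h1 : (⌈T⌉₊ : ℝ) < T + 1 := Nat.ceil_lt_add_one (by linarith)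
  have : 2 * Real.log T = Real.log (T^2) := by rw [Real.log_pow]; push_cast; ring
  rw [this]
  apply Real.log_le_log (by positivity)
  push_cast
  nlinarith

lemma err_tendsto (g g' g'' : ℝ → ℝ) (hg : ∀ r, HasDerivAt g (g' r) r) (hg' : ∀ r, HasDerivAt g' (g'' r) r)
    (M : ℝ) (hM1 : ∀ r, |g' r| ≤ M) (hM2 : ∀ r, |g'' r| ≤ M)
    (huc : UniformContinuous g'')
    (a c c' : ℝ) (ha : 0 < a) (h0 : ∀ r < a, g r = c) (h0' : ∀ r < a, g' r = 0) (h0'' : ∀ r < a, g'' r = 0)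
    (h1 : ∀ r > 1/2, g r = c') (h1' : ∀ r > 1/2, g' r = 0) (h1'' : ∀ r > 1/2, g'' r = 0) :
    Tendsto (fun T => ∑' x, errE (Real.log T) (fun x => g (sig T x)) (LLf g'' T) (PPa g' T) (PPb g' T) x)
      atTop (nhds 0) := by
  rw [Metric.tendsto_nhds]
  intro ε0 hε0
  have hM : 0 ≤ M := (abs_nonneg _).trans (hM1 0)
  set ε := ε0 / 400 with hεd
  have hε : 0 < ε := by positivity
  obtain ⟨δ0, hδ0, hδ⟩ := Metric.uniformContinuous_iff.mp huc ε hε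
  set C := 272 * M + 16 * M^2 + 16 * M^3 with hC
  have hC0 : 0 ≤ C := by positivity
  have ev1 : ∀ᶠ T : ℝ in atTop, 2 + 4 / δ0 + 2 * M ≤ T^a - 1 := by
    have := (tendsto_rpow_atTop ha).eventually_ge_atTop (3 + 4 / δ0 + 2 * M)
    filter_upwards [this] with T hT
    linarith
  have ev2 : ∀ᶠ T : ℝ in atTop, C * Real.log T ≤ ε * (T^a - 1) := by
    have := (isLittleO_log_rpow_atTop ha).def (c := ε / (2 * (C + 1))) (by positivity)
    filter_upwards [this, (tendsto_rpow_atTop ha).eventually_ge_atTop 2, eventually_ge_atTop 1] with T h1 h2 h3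
    rw [Real.norm_eq_abs, Real.norm_eq_abs, abs_of_nonneg (Real.log_nonneg h3),
      abs_of_nonneg (by positivity)] at h1
    calc C * Real.log T ≤ (C+1) * (ε / (2 * (C + 1)) * T^a) := by
          have := Real.log_nonneg h3
          gcongr; linarith
      _ = ε * (T^a / 2) := by field_simp
      _ ≤ _ := by gcongr; linarith
  filter_upwards [ev1, ev2, eventually_ge_atTop 3, Real.tendsto_log_atTop.eventually_ge_atTop 1]
    with T hT1 hT2 hT3 hD
  set D := Real.log T with hDd
  have hD0 : 0 < D := by linarith
  set N : ℕ := ⌈T⌉₊ + 2 with hN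
  have hTN : T + 2 ≤ N := by
    have := Nat.le_ceil T
    rw [hN]; push_cast; linarith
  set E := errE D (fun x => g (sig T x)) (LLf g'' T) (PPa g' T) (PPb g' T) with hE
  have hout : ∀ x ∉ Finset.Icc (-(N : ℤ × ℤ)) N, E x = 0 := by
    intro x hx
    obtain ⟨o0, o1, o2, o3, o4⟩ := nsq_out T (by linarith) N hTN x hx
    have s := fun y h => sig_ge T (by linarith) y h
    refine errE_zero _ c' _ _ _ _ _ (h1 _ (s _ o0)) (h1 _ (s _ o1)) (h1 _ (s _ o2)) (h1 _ (s _ o3))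
      (h1 _ (s _ o4)) ?_ ?_ ?_
    · simp [LLf, h1'' _ (s _ o0)]
    · simp [PPa, h1' _ (s _ o0)]
    · simp [PPb, h1' _ (s _ o0)]
  have hnn : ∀ x, 0 ≤ E x := fun x => errE_nonneg _ hD0.le _ _ _ _ _
  have hpt : ∀ x, E x ≤ 9 * ε / D * (if x ≠ 0 then 1 / (((x.1 : ℝ)) ^ 2 + ((x.2 : ℝ)) ^ 2) else 0) := by
    intro x
    have hn0 : 0 ≤ nsq x := by unfold nsq; positivity
    set ρ := Real.sqrt (nsq x) with hρ
    have hρ0 : 0 ≤ ρ := Real.sqrt_nonneg _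
    have hρ2 : nsq x = ρ^2 := (Real.sq_sqrt hn0).symm
    by_cases hlow : ρ + 1 < T^a
    · have hz : E x = 0 := by
        obtain ⟨o1, o2, o3, o4⟩ := nsq_nbr x ρ hρ0 hρ2
        have s := fun y h => sig_low T a ha (by linarith) y h
        have hsq : (ρ+1)^2 < (T^a)^2 := by gcongr
        have s0 := s x (by rw [hρ2]; refine lt_trans ?_ hsq; gcongr; linarith)
        refine errE_zero _ c _ _ _ _ _ (h0 _ s0) (h0 _ (s _ (o1.trans_lt hsq)))
          (h0 _ (s _ (o2.trans_lt hsq))) (h0 _ (s _ (o3.trans_lt hsq))) (h0 _ (s _ (o4.trans_lt hsq)))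
          ?_ ?_ ?_
        · simp [LLf, h0'' _ s0]
        · simp [PPa, h0' _ s0]
        · simp [PPb, h0' _ s0]
      rw [hz]
      split_ifs <;> positivity
    · push Not at hlow
      have hd4 : 0 < 4 / δ0 := by positivity
      have hρbig : 2 + 4 / δ0 + 2 * M ≤ ρ := by linarith
      have hρpos : 0 < ρ := by linarith
      have hx : x ≠ 0 := by
        intro h
        rw [h] at hρ2
        simp [nsq] at hρ2
        exact (pow_pos hρpos 2).ne hρ2
      have hb := errE_bound g g' g'' hg hg' M hM1 hM2 ε (δ0/2) hε
        (fun r s hrs => (hδ (a := r) (b := s) (by rw [Real.dist_eq]; linarith)).le) T hD x ρ (by linarith)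
        (by
          have : 4 / δ0 * (δ0 / 2) = 2 := by field_simp; norm_num
          calc (2:ℝ) = 4 / δ0 * (δ0 / 2) := this.symm
            _ ≤ ρ * (δ0 / 2) := by gcongr; linarith) (by linarith) hρ2
      refine hb.trans ?_
      rw [if_pos hx]
      have : ((x.1 : ℝ)) ^ 2 + ((x.2 : ℝ)) ^ 2 = ρ^2 := hρ2
      rw [this]
      have hCD : C / ρ^3 ≤ ε / (D * ρ^2) := by
        rw [div_le_div_iff₀ (by positivity) (by positivity)]
        have h2 : C * D ≤ ε * ρ := hT2.trans (by gcongr; linarith)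
        calc C * (D * ρ^2) = (C * D) * ρ^2 := by ring
          _ ≤ (ε * ρ) * ρ^2 := by gcongr
          _ = _ := by ring
      calc _ ≤ 8 * ε / (D * ρ^2) + ε / (D * ρ^2) := by gcongr
        _ = _ := by field_simp; ring
  have hsum : ∑' x, E x ≤ 9 * ε / D * (8 * (1 + 2 * D)) := by
    rw [tsum_eq_sum hout]
    calc _ ≤ ∑ x ∈ Finset.Icc (-(N : ℤ × ℤ)) N, 9 * ε / D *
          (if x ≠ 0 then 1 / (((x.1 : ℝ)) ^ 2 + ((x.2 : ℝ)) ^ 2) else 0) :=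
          Finset.sum_le_sum fun x _ => hpt x
      _ = 9 * ε / D * ∑ x ∈ Finset.Icc (-(N : ℤ × ℤ)) N,
          (if x ≠ 0 then 1 / (((x.1 : ℝ)) ^ 2 + ((x.2 : ℝ)) ^ 2) else 0) := by rw [Finset.mul_sum]
      _ ≤ 9 * ε / D * (8 * (1 + 2 * D)) := by
          gcongr
          refine (sum_box N).trans ?_
          have := harmonic_le_one_add_log N
          have := log_ceil T hT3
          gcongr
          linarith
  rw [Real.dist_eq, sub_zero, abs_of_nonneg (tsum_nonneg hnn)]
  refine hsum.trans_lt ?_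
  calc 9 * ε / D * (8 * (1 + 2 * D)) ≤ 9 * ε / D * (8 * (D + 2 * D)) := by gcongr
    _ = 216 * ε := by field_simp; norm_num
    _ < ε0 := by rw [hεd]; linarith

lemma const_of_deriv_zero_Iio (f : ℝ → ℝ) (hf : Differentiable ℝ f) (a : ℝ)
    (h : ∀ r < a, deriv f r = 0) : ∃ c, ∀ r < a, f r = c := by
  refine ⟨f (a - 1), fun r hr => ?_⟩
  have := (convex_Iio a).norm_image_sub_le_of_norm_deriv_le (f := f) (C := 0)
    (fun x _ => hf x) (fun x hx => by rw [h x hx]; simp) (x := a - 1) (y := r)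
    (by simp) hr
  simp at this
  linarith

lemma deriv_zero_of_open (f : ℝ → ℝ) (U : Set ℝ) (hU : IsOpen U) (c : ℝ) (h : ∀ r ∈ U, f r = c) :
    ∀ r ∈ U, deriv f r = 0 := by
  intro r hr
  have : f =ᶠ[nhds r] fun _ => c := by
    filter_upwards [hU.mem_nhds hr] with y hy using h y hy
  rw [this.deriv_eq]; simp

/-- Expansion of the exponential corrector of the Radon-Nikodym derivative:
`(log T/T) log Ψ_dyn = -π ∫ Γ'' dμ^{1,T} - W_γ + o_T(1)`, uniformly over the
configurations. -/
theorem stmt17 (α : ℝ) (hα : α ∈ Set.Ioo (0:ℝ) 1)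
    (γ : ℝ → ℝ) (hγ : ContDiff ℝ 2 γ)
    (hrange : ∀ r, γ r ∈ Set.Ioo (0:ℝ) 1)
    (hsupp : tsupport (deriv γ) ⊆ Set.Ioo 0 (1/2))
    (hconst : ∀ r : ℝ, 1/2 ≤ r → γ r = α)
    (Γ : ℝ → ℝ)
    (hΓ : Γ = fun u => (1/2) * (Real.log (γ u / (1 - γ u)) - Real.log (α / (1 - α)))) :
    ∃ e : ℝ → ℝ, Tendsto e atTop (nhds 0) ∧
      ∀ T : ℝ, 2 ≤ T →
        ∀ η : ℤ × ℤ → ℝ, (∀ x, η x = 0 ∨ η x = 1) →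
          |(Real.log T / T) *
              (-(T / 2) * ∑' x : ℤ × ℤ,
                (η x * (1 - η (x + (1, 0))) *
                    (Real.exp (Γ (sig T (x + (1, 0))) - Γ (sig T x)) - 1)
                  + η x * (1 - η (x - (1, 0))) *
                      (Real.exp (Γ (sig T (x - (1, 0))) - Γ (sig T x)) - 1)
                  + η x * (1 - η (x + (0, 1))) *
                      (Real.exp (Γ (sig T (x + (0, 1))) - Γ (sig T x)) - 1)
                  + η x * (1 - η (x - (0, 1))) *
                      (Real.exp (Γ (sig T (x - (0, 1))) - Γ (sig T x)) - 1)))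
            + (1 / (2 * Real.log T)) *
                (∑' x : ℤ × ℤ,
                  if x ≠ 0 then η x * deriv (deriv Γ) (sig T x) / nsq x else 0)
            + (1 / (4 * Real.log T)) *
                ((∑' x : ℤ × ℤ,
                    if x ≠ 0 then (deriv Γ (sig T x)) ^ 2 *
                      (((x.1 : ℝ)) ^ 2 / (nsq x) ^ 2) *
                        (η (x + (1, 0)) - η x) ^ 2 else 0)
                  + ∑' x : ℤ × ℤ,
                      if x ≠ 0 then (deriv Γ (sig T x)) ^ 2 *
                        (((x.2 : ℝ)) ^ 2 / (nsq x) ^ 2) *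
                          (η (x + (0, 1)) - η x) ^ 2 else 0)|
            ≤ e T := by
  have hγ1 : ∀ r, 0 < γ r := fun r => (hrange r).1
  have hγ2 : ∀ r, 0 < 1 - γ r := fun r => by linarith [(hrange r).2]
  have hΓc : ContDiff ℝ 2 Γ := by
    rw [hΓ]
    refine contDiff_const.mul (ContDiff.sub (ContDiff.log (hγ.div (contDiff_const.sub hγ)
      (fun r => (hγ2 r).ne')) (fun r => (div_pos (hγ1 r) (hγ2 r)).ne')) contDiff_const)
  -- constancy near zero
  obtain ⟨a, ha, hlow⟩ : ∃ a > 0, ∀ r < a, deriv γ r = 0 := by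
    have h0 : (0:ℝ) ∈ (tsupport (deriv γ))ᶜ := fun h => lt_irrefl _ (hsupp h).1
    obtain ⟨a, ha, hb⟩ := Metric.isOpen_iff.mp (isClosed_tsupport (deriv γ)).isOpen_compl 0 h0
    refine ⟨a, ha, fun r hr => ?_⟩
    apply image_eq_zero_of_notMem_tsupport
    intro hm
    have hr0 := (hsupp hm).1
    exact hb (by simp [abs_of_pos hr0, hr]) hm
  obtain ⟨c, hc⟩ := const_of_deriv_zero_Iio γ (hγ.differentiable (by norm_num)) a hlow
  have g0 : ∀ r < a, Γ r = (1/2) * (Real.log (c / (1 - c)) - Real.log (α / (1 - α))) := by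
    intro r hr
    rw [hΓ]; simp only [hc r hr]
  have g1 : ∀ r > 1/2, Γ r = 0 := by
    intro r hr
    rw [hΓ]; simp only [hconst r hr.le]; ring
  have g0' := deriv_zero_of_open Γ (Iio a) isOpen_Iio _ g0
  have g1' := deriv_zero_of_open Γ (Ioi (1/2)) isOpen_Ioi _ g1
  have g0'' := deriv_zero_of_open (deriv Γ) (Iio a) isOpen_Iio _ g0'
  have g1'' := deriv_zero_of_open (deriv Γ) (Ioi (1/2)) isOpen_Ioi _ g1'
  have hd1 : ContDiff ℝ 1 (deriv Γ) := by
    have : ContDiff ℝ (1 + 1) Γ := by exact_mod_cast hΓc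
    exact (contDiff_succ_iff_deriv.mp this).2.2
  have hd2 : Continuous (deriv (deriv Γ)) := hd1.continuous_deriv le_rfl
  have hcs : ∀ f : ℝ → ℝ, (∀ r ∈ Iio a, f r = 0) → (∀ r ∈ Ioi (1/2 : ℝ), f r = 0) →
      HasCompactSupport f := fun f h h' => by
    apply HasCompactSupport.intro (K := Icc a (1/2)) isCompact_Icc
    intro r hr
    rw [mem_Icc, not_and_or, not_le, not_le] at hr
    exact hr.elim (h r) (h' r)
  have cs1 := hcs _ g0' g1'
  have cs2 := hcs _ g0'' g1''
  obtain ⟨M1, hM1⟩ := cs1.exists_bound_of_continuous hd1.continuous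
  obtain ⟨M2, hM2⟩ := cs2.exists_bound_of_continuous hd2
  have huc : UniformContinuous (deriv (deriv Γ)) := cs2.uniformContinuous_of_continuous hd2
  refine ⟨fun T => ∑' x, errE (Real.log T) (fun x => Γ (sig T x)) (LLf (deriv (deriv Γ)) T)
    (PPa (deriv Γ) T) (PPb (deriv Γ) T) x, ?_, ?_⟩
  · exact err_tendsto Γ (deriv Γ) (deriv (deriv Γ))
      (fun r => (hΓc.differentiable (by norm_num) r).hasDerivAt)
      (fun r => (hd1.differentiable (by norm_num) r).hasDerivAt)
      (max M1 M2) (fun r => (hM1 r).trans (le_max_left _ _)) (fun r => (hM2 r).trans (le_max_right _ _))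
      huc a _ 0 ha g0 g0' g0'' g1 g1' g1''
  · intro T hT η hη
    have hD : 0 < Real.log T := Real.log_pos (by linarith)
    have hTN : T + 2 ≤ ((⌈T⌉₊ + 2 : ℕ) : ℝ) := by
      have := Nat.le_ceil T
      push_cast; linarith
    set S := Finset.Icc (-((⌈T⌉₊ + 2 : ℕ) : ℤ × ℤ)) ((⌈T⌉₊ + 2 : ℕ) : ℤ × ℤ) with hS
    have ho := fun x (hx : x ∉ S) => nsq_out T hT _ hTN x hx
    have s := fun y h => sig_ge T hT y h
    have key := main_ident S (Real.log T) T hD (by linarith) (fun x => Γ (sig T x))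
      (LLf (deriv (deriv Γ)) T) (PPa (deriv Γ) T) (PPb (deriv Γ) T) η hη
      (fun x hx => by
        obtain ⟨o0, o1, o2, o3, o4⟩ := ho x hx
        simp only [g1 _ (s _ o0), g1 _ (s _ o1)])
      (fun x hx => by
        obtain ⟨o0, o1, o2, o3, o4⟩ := ho x hx
        simp only [g1 _ (s _ o0), g1 _ (s _ o2)])
      (fun x hx => by
        obtain ⟨o0, o1, o2, o3, o4⟩ := ho x hx
        simp only [g1 _ (s _ o0), g1 _ (s _ o3)])
      (fun x hx => by
        obtain ⟨o0, o1, o2, o3, o4⟩ := ho x hx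
        simp only [g1 _ (s _ o0), g1 _ (s _ o4)])
      (fun x hx => by simp [LLf, g1'' _ (s _ (ho x hx).1)])
      (fun x hx => by simp [PPa, g1' _ (s _ (ho x hx).1)])
      (fun x hx => by simp [PPb, g1' _ (s _ (ho x hx).1)])
    have t1 : ∀ x : ℤ × ℤ, (if x ≠ 0 then η x * deriv (deriv Γ) (sig T x) / nsq x else 0)
        = η x * LLf (deriv (deriv Γ)) T x := fun x => by
      unfold LLf; split_ifs <;> ring
    have t2 : ∀ x : ℤ × ℤ, (if x ≠ 0 then (deriv Γ (sig T x)) ^ 2 *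
          (((x.1 : ℝ)) ^ 2 / (nsq x) ^ 2) * (η (x + (1, 0)) - η x) ^ 2 else 0)
        = PPa (deriv Γ) T x * (η (x + (1, 0)) - η x) ^ 2 := fun x => by
      unfold PPa; split_ifs <;> ring
    have t3 : ∀ x : ℤ × ℤ, (if x ≠ 0 then (deriv Γ (sig T x)) ^ 2 *
          (((x.2 : ℝ)) ^ 2 / (nsq x) ^ 2) * (η (x + (0, 1)) - η x) ^ 2 else 0)
        = PPb (deriv Γ) T x * (η (x + (0, 1)) - η x) ^ 2 := fun x => by
      unfold PPb; split_ifs <;> ring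
    rw [tsum_congr t1, tsum_congr t2, tsum_congr t3]
    exact key
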